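/- For every real p ≥ 1 and every v in the open interval (0, (1/4)^(1/p)), the function g_p is differentiable at v and its derivative is given by g_p'(v) = −2∫_{r₋(v)}^{r₊(v)} ((1 − r^p)^(2/p) − v²/r²)^(−1/2) · (v/r²) dr; in particular g_p'(v) < 0. -/

import Mathlib

open Real

/-- `r₋(v) = (1/2 − √(1/4 − v^p))^(1/p)`. -/
noncomputable def rMinus (p v : ℝ) : ℝ := (1 / 2 - Real.sqrt (1 / 4 - v ^ p)) ^ (1 / p)

/-- `r₊(v) = (1/2 + √(1/4 − v^p))^(1/p)`. -/
noncomputable def rPlus (p v : ℝ) : ℝ := (1 / 2 + Real.sqrt (1 / 4 - v ^ p)) ^ (1 / p)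

/-- `g_p(v) = 2∫_{r₋(v)}^{r₊(v)} √((1 − r^p)^(2/p) − v²/r²) dr`. -/
noncomputable def g (p v : ℝ) : ℝ :=
  2 * ∫ r in rMinus p v..rPlus p v, Real.sqrt ((1 - r ^ p) ^ (2 / p) - v ^ 2 / r ^ 2)

open MeasureTheory Filter Topology Set

/-- If `f` is continuous and vanishes at `(v, a v)`, the integral of `f w` over the short interval
from `a v` to `a w` is `o(w - v)`. -/
lemma hasDerivAt_integral_moving_endpoint {f : ℝ → ℝ → ℝ} {a : ℝ → ℝ} {v : ℝ}
    (hf : ContinuousAt (fun z : ℝ × ℝ => f z.1 z.2) (v, a v)) (h0 : f v (a v) = 0)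
    (ha : DifferentiableAt ℝ a v) :
    HasDerivAt (fun w => ∫ r in a v..a w, f w r) 0 v := by
  rw [hasDerivAt_iff_isLittleO]
  simp only [intervalIntegral.integral_same, sub_zero, smul_zero]
  have hO : (fun w => a w - a v) =O[𝓝 v] fun w => w - v := ha.hasDerivAt.isBigO_sub
  refine Asymptotics.IsLittleO.trans_isBigO ?_ hO
  rw [Asymptotics.isLittleO_iff]
  intro ε hε
  obtain ⟨δ, hδ, hb⟩ := Metric.continuousAt_iff.1 hf ε hε
  have h1 : ∀ᶠ w in 𝓝 v, dist (a w) (a v) < δ := ha.continuousAt (Metric.ball_mem_nhds _ hδ)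
  have h2 : ∀ᶠ w in 𝓝 v, dist w v < δ := Metric.ball_mem_nhds _ hδ
  filter_upwards [h1, h2] with w hw1 hw2
  refine intervalIntegral.norm_integral_le_of_norm_le_const fun r hr => ?_
  have hr' : dist r (a v) < δ := by
    refine lt_of_le_of_lt ?_ hw1
    rw [Real.dist_eq, Real.dist_eq]
    exact Set.abs_sub_left_of_mem_uIcc (uIoc_subset_uIcc hr)
  have := @hb (w, r) (by rw [Prod.dist_eq]; exact max_lt hw2 hr')
  simp only [h0, dist_zero_right] at this
  exact this.le

lemma abs_sqrt_sub_sqrt_le (x : ℝ) {y : ℝ} (hy : 0 < y) :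
    |√x - √y| ≤ |x - y| * y ^ (-(1 / 2 : ℝ)) := by
  rw [Real.rpow_neg hy.le, ← Real.sqrt_eq_rpow, ← div_eq_mul_inv, le_div_iff₀ (by positivity)]
  have hsy := Real.sq_sqrt hy.le
  have hp := Real.sqrt_pos.2 hy
  rcases le_total 0 x with hx | hx
  · have hsx := Real.sq_sqrt hx
    have hn := Real.sqrt_nonneg x
    have : x - y = (√x - √y) * (√x + √y) := by nlinarith
    rw [this, abs_mul, abs_of_nonneg (by positivity : 0 ≤ √x + √y)]
    gcongr
    linarith
  · rw [Real.sqrt_eq_zero_of_nonpos hx, zero_sub, abs_neg, abs_of_pos hp,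
      abs_of_nonpos (by linarith)]
    nlinarith

/-- The arcsine density is integrable. -/
lemma intervalIntegrable_rpow_neg_half_mul {a b : ℝ} (hab : a < b) :
    IntervalIntegrable (fun r => ((r - a) * (b - r)) ^ (-(1 / 2 : ℝ))) volume a b := by
  have h1 : IntervalIntegrable (fun r => (r - a) ^ (-(1 / 2 : ℝ))) volume a b := by
    have := (intervalIntegral.intervalIntegrable_rpow' (a := 0) (b := b - a)
      (by norm_num : (-1 : ℝ) < -(1 / 2))).comp_sub_right a
    simpa using this
  have h2 : IntervalIntegrable (fun r => (b - r) ^ (-(1 / 2 : ℝ))) volume a b := by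
    have := (intervalIntegral.intervalIntegrable_rpow' (a := b - a) (b := 0)
      (by norm_num : (-1 : ℝ) < -(1 / 2))).comp_sub_left b
    simpa using this
  have h := (h1.add h2).const_mul ((b - a) ^ (-(1 / 2 : ℝ)))
  rw [intervalIntegrable_iff_integrableOn_Ioo_of_le hab.le] at h ⊢
  refine h.mono' (Measurable.aestronglyMeasurable (by fun_prop)) ?_
  rw [ae_restrict_iff' measurableSet_Ioo]
  refine Eventually.of_forall fun r ⟨hr1, hr2⟩ => ?_
  have hx : 0 < r - a := sub_pos.2 hr1
  have hy : 0 < b - r := sub_pos.2 hr2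
  have hL : 0 < b - a := sub_pos.2 hab
  rw [Real.norm_of_nonneg (by positivity)]
  simp only [Real.rpow_neg hx.le, Real.rpow_neg hy.le, Real.rpow_neg hL.le,
    Real.rpow_neg (mul_pos hx hy).le, ← Real.sqrt_eq_rpow]
  rw [Real.sqrt_mul hx.le]
  have hsum : √(b - a) ≤ √(r - a) + √(b - r) := by
    rw [Real.sqrt_le_left (by positivity)]
    nlinarith [Real.sq_sqrt hx.le, Real.sq_sqrt hy.le, Real.sqrt_nonneg (r - a),
      Real.sqrt_nonneg (b - r), mul_nonneg (Real.sqrt_nonneg (r - a)) (Real.sqrt_nonneg (b - r))]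
  have h1 := Real.sqrt_pos.2 hx
  have h2 := Real.sqrt_pos.2 hy
  have h3 := Real.sqrt_pos.2 hL
  have : (√(b - a))⁻¹ * ((√(r - a))⁻¹ + (√(b - r))⁻¹) =
      (√(r - a) * √(b - r))⁻¹ * ((√(r - a) + √(b - r)) / √(b - a)) := by
    field_simp
    ring
  rw [this]
  exact le_mul_of_one_le_right (by positivity) ((one_le_div h3).2 hsum)

lemma mul_sub_le_rpow_sub_rpow {p x y : ℝ} (hp : 1 ≤ p) (hx : 0 < x) (hxy : x ≤ y) :
    x ^ (p - 1) * (y - x) ≤ y ^ p - x ^ p := by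
  have hy := hx.trans_le hxy
  have h1 : x ^ p = x ^ (p - 1) * x := by
    rw [← Real.rpow_add_one hx.ne']; congr 1; ring
  have h2 : y ^ p = y ^ (p - 1) * y := by
    rw [← Real.rpow_add_one hy.ne']; congr 1; ring
  have h3 : x ^ (p - 1) ≤ y ^ (p - 1) := Real.rpow_le_rpow hx.le hxy (by linarith)
  rw [h1, h2]
  nlinarith

lemma rpow_sub_rpow_le {p x y : ℝ} (hp : 1 ≤ p) (hx : 0 < x) (hxy : x ≤ y) (hy : y ≤ 1) :
    y ^ p - x ^ p ≤ p * (y - x) := by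
  have hy0 := hx.trans_le hxy
  have hB := one_add_mul_self_le_rpow_one_add (s := x / y - 1)
    (by have := div_pos hx hy0; linarith) hp
  rw [add_sub_cancel, Real.div_rpow hx.le hy0.le, le_div_iff₀ (by positivity)] at hB
  have h1 : y ^ p ≤ y := by
    simpa using Real.rpow_le_rpow_of_exponent_ge hy0 hy hp
  have h2 : y ^ p - x ^ p ≤ p * (1 - x / y) * y ^ p := by nlinarith
  have h3 : 0 ≤ 1 - x / y := sub_nonneg.2 ((div_le_one hy0).2 hxy)
  calc y ^ p - x ^ p ≤ p * (1 - x / y) * y ^ p := h2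
    _ ≤ p * (1 - x / y) * y := by gcongr
    _ = p * (y - x) := by field_simp

section

variable {p v : ℝ}

lemma rpow_mem_Ioo (hp : 1 ≤ p) (hv : v ∈ Ioo 0 ((1 / 4 : ℝ) ^ (1 / p))) :
    v ^ p ∈ Ioo (0 : ℝ) (1 / 4) := by
  refine ⟨Real.rpow_pos_of_pos hv.1 p, ?_⟩
  have := Real.rpow_lt_rpow hv.1.le hv.2 (by linarith : 0 < p)
  rwa [← Real.rpow_mul (by norm_num), one_div_mul_cancel (by linarith), Real.rpow_one] at this

lemma sqrt_quarter_sub_mem_Ioo (hp : 1 ≤ p) (hv : v ∈ Ioo 0 ((1 / 4 : ℝ) ^ (1 / p))) :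
    √(1 / 4 - v ^ p) ∈ Ioo (0 : ℝ) (1 / 2) := by
  obtain ⟨h1, h2⟩ := rpow_mem_Ioo hp hv
  refine ⟨Real.sqrt_pos.2 (by linarith), ?_⟩
  rw [Real.sqrt_lt' (by norm_num)]
  linarith

lemma rMinus_rpow (hp : 1 ≤ p) (hv : v ∈ Ioo 0 ((1 / 4 : ℝ) ^ (1 / p))) :
    rMinus p v ^ p = 1 / 2 - √(1 / 4 - v ^ p) := by
  have h := sqrt_quarter_sub_mem_Ioo hp hv
  rw [rMinus, ← Real.rpow_mul (by linarith [h.2]), one_div_mul_cancel (by linarith), Real.rpow_one]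

lemma rPlus_rpow (hp : 1 ≤ p) (hv : v ∈ Ioo 0 ((1 / 4 : ℝ) ^ (1 / p))) :
    rPlus p v ^ p = 1 / 2 + √(1 / 4 - v ^ p) := by
  have h := sqrt_quarter_sub_mem_Ioo hp hv
  rw [rPlus, ← Real.rpow_mul (by linarith [h.1]), one_div_mul_cancel (by linarith), Real.rpow_one]

lemma rMinus_pos (hp : 1 ≤ p) (hv : v ∈ Ioo 0 ((1 / 4 : ℝ) ^ (1 / p))) : 0 < rMinus p v :=
  Real.rpow_pos_of_pos (by linarith [(sqrt_quarter_sub_mem_Ioo hp hv).2]) _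

lemma rMinus_lt_rPlus (hp : 1 ≤ p) (hv : v ∈ Ioo 0 ((1 / 4 : ℝ) ^ (1 / p))) :
    rMinus p v < rPlus p v := by
  have h := sqrt_quarter_sub_mem_Ioo hp hv
  exact Real.rpow_lt_rpow (by linarith [h.2]) (by linarith [h.1]) (by positivity)

lemma rPlus_lt_one (hp : 1 ≤ p) (hv : v ∈ Ioo 0 ((1 / 4 : ℝ) ^ (1 / p))) : rPlus p v < 1 := by
  have h := sqrt_quarter_sub_mem_Ioo hp hv
  exact Real.rpow_lt_one (by linarith [h.1]) (by linarith [h.2]) (by positivity)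

lemma differentiableAt_rMinus (hp : 1 ≤ p) (hv : v ∈ Ioo 0 ((1 / 4 : ℝ) ^ (1 / p))) :
    DifferentiableAt ℝ (rMinus p) v := by
  have h := sqrt_quarter_sub_mem_Ioo hp hv
  have h' := rpow_mem_Ioo hp hv
  unfold rMinus
  refine DifferentiableAt.rpow_const (DifferentiableAt.const_sub (DifferentiableAt.sqrt
    (DifferentiableAt.const_sub (differentiableAt_id.rpow_const (Or.inl hv.1.ne')) _) ?_) _)
    (Or.inl ?_)
  · simp only [id]; linarith [h'.2]
  · linarith [h.2]

lemma differentiableAt_rPlus (hp : 1 ≤ p) (hv : v ∈ Ioo 0 ((1 / 4 : ℝ) ^ (1 / p))) :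
    DifferentiableAt ℝ (rPlus p) v := by
  have h := sqrt_quarter_sub_mem_Ioo hp hv
  have h' := rpow_mem_Ioo hp hv
  unfold rPlus
  refine DifferentiableAt.rpow_const (DifferentiableAt.const_add _ (DifferentiableAt.sqrt
    (DifferentiableAt.const_sub (differentiableAt_id.rpow_const (Or.inl hv.1.ne')) _) ?_))
    (Or.inl ?_)
  · linarith [h'.2]
  · linarith [h.1]

/-- The radicand is `(F² - v²) / r²` with `F = r (1 - r ^ p) ^ (1 / p)`. -/
lemma radicand_eq {r : ℝ} (hr : 0 < r) (hrp : r ^ p ≤ 1) :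
    (1 - r ^ p) ^ (2 / p) - v ^ 2 / r ^ 2 =
      ((r * (1 - r ^ p) ^ (1 / p)) ^ 2 - v ^ 2) / r ^ 2 := by
  have : (1 - r ^ p) ^ (2 / p) = ((1 - r ^ p) ^ (1 / p)) ^ 2 := by
    rw [← Real.rpow_natCast, ← Real.rpow_mul (by linarith)]
    congr 1
    push_cast
    ring
  rw [this]
  field_simp

lemma mul_one_sub_rpow_rpow {r : ℝ} (hp : 1 ≤ p) (hr : 0 < r) (hrp : r ^ p ≤ 1) :
    (r * (1 - r ^ p) ^ (1 / p)) ^ p = r ^ p * (1 - r ^ p) := by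
  have h : 0 ≤ 1 - r ^ p := by linarith
  rw [Real.mul_rpow hr.le (by positivity), ← Real.rpow_mul h, one_div_mul_cancel (by linarith),
    Real.rpow_one]

lemma radicand_eq_zero {r : ℝ} (hp : 1 ≤ p) (hv : 0 < v) (hr : 0 < r) (hrp : r ^ p ≤ 1)
    (h : r ^ p * (1 - r ^ p) = v ^ p) : (1 - r ^ p) ^ (2 / p) - v ^ 2 / r ^ 2 = 0 := by
  have h1 : 0 ≤ 1 - r ^ p := by linarith
  have h2 : r * (1 - r ^ p) ^ (1 / p) = v := by
    refine (Real.rpow_left_inj (by positivity) hv.le (by linarith : p ≠ 0)).1 ?_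
    rw [mul_one_sub_rpow_rpow hp hr hrp, h]
  rw [radicand_eq hr hrp, h2, sub_self, zero_div]

lemma radicand_rMinus (hp : 1 ≤ p) (hv : v ∈ Ioo 0 ((1 / 4 : ℝ) ^ (1 / p))) :
    (1 - rMinus p v ^ p) ^ (2 / p) - v ^ 2 / rMinus p v ^ 2 = 0 := by
  have h := sqrt_quarter_sub_mem_Ioo hp hv
  have hs := Real.sq_sqrt (by linarith [(rpow_mem_Ioo hp hv).2] : 0 ≤ 1 / 4 - v ^ p)
  refine radicand_eq_zero hp hv.1 (rMinus_pos hp hv) ?_ ?_ <;> rw [rMinus_rpow hp hv]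
  · linarith [h.1]
  · nlinarith

lemma radicand_rPlus (hp : 1 ≤ p) (hv : v ∈ Ioo 0 ((1 / 4 : ℝ) ^ (1 / p))) :
    (1 - rPlus p v ^ p) ^ (2 / p) - v ^ 2 / rPlus p v ^ 2 = 0 := by
  have h := sqrt_quarter_sub_mem_Ioo hp hv
  have hs := Real.sq_sqrt (by linarith [(rpow_mem_Ioo hp hv).2] : 0 ≤ 1 / 4 - v ^ p)
  refine radicand_eq_zero hp hv.1 ((rMinus_pos hp hv).trans (rMinus_lt_rPlus hp hv)) ?_ ?_ <;>
    rw [rPlus_rpow hp hv]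
  · linarith [h.2]
  · nlinarith

/-- The radicand vanishes at most linearly at the endpoints. -/
lemma exists_le_radicand (hp : 1 ≤ p) (hv : v ∈ Ioo 0 ((1 / 4 : ℝ) ^ (1 / p))) :
    ∃ k : ℝ, 0 < k ∧ ∀ r ∈ Ioo (rMinus p v) (rPlus p v),
      k * ((r - rMinus p v) * (rPlus p v - r)) ≤ (1 - r ^ p) ^ (2 / p) - v ^ 2 / r ^ 2 := by
  have ha := rMinus_pos hp hv
  have hb1 := rPlus_lt_one hp hv
  have hsq := Real.sq_sqrt (by linarith [(rpow_mem_Ioo hp hv).2] : 0 ≤ 1 / 4 - v ^ p)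
  have hap := rMinus_rpow hp hv
  have hbp := rPlus_rpow hp hv
  set a := rMinus p v
  set b := rPlus p v
  have hv0 := hv.1
  refine ⟨v / p * (a ^ (p - 1)) ^ 2, by positivity, fun r ⟨har, hrb⟩ => ?_⟩
  have hr := ha.trans har
  have hr1 : r < 1 := hrb.trans hb1
  have hrp : r ^ p ≤ 1 := Real.rpow_le_one hr.le hr1.le (by linarith)
  have hrp0 : 0 < r ^ p := by positivity
  rw [radicand_eq hr hrp]
  have hFp := mul_one_sub_rpow_rpow hp hr hrp
  have h1r : 0 ≤ 1 - r ^ p := by linarith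
  have hF0 : 0 ≤ r * (1 - r ^ p) ^ (1 / p) := by positivity
  have hF1 : r * (1 - r ^ p) ^ (1 / p) ≤ 1 :=
    mul_le_one₀ hr1.le (by positivity) (Real.rpow_le_one h1r (by linarith) (by positivity))
  set F := r * (1 - r ^ p) ^ (1 / p)
  have h1 : a ^ (p - 1) * (r - a) ≤ r ^ p - a ^ p := mul_sub_le_rpow_sub_rpow hp ha har.le
  have h2 : a ^ (p - 1) * (b - r) ≤ b ^ p - r ^ p := by
    refine le_trans ?_ (mul_sub_le_rpow_sub_rpow hp hr hrb.le)
    have : a ^ (p - 1) ≤ r ^ (p - 1) := Real.rpow_le_rpow ha.le har.le (by linarith)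
    exact mul_le_mul_of_nonneg_right this (by linarith)
  have hra : 0 < r - a := sub_pos.2 har
  have hbr : 0 < b - r := sub_pos.2 hrb
  have h3 : (a ^ (p - 1) * (r - a)) * (a ^ (p - 1) * (b - r)) ≤ F ^ p - v ^ p := by
    have : F ^ p - v ^ p = (r ^ p - a ^ p) * (b ^ p - r ^ p) := by
      rw [hFp, hap, hbp]; nlinarith
    rw [this]
    exact mul_le_mul h1 h2 (by positivity) (le_trans (by positivity) h1)
  have hvF : v ≤ F := by
    refine (Real.rpow_le_rpow_iff hv0.le hF0 (by linarith : 0 < p)).1 ?_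
    have : 0 ≤ (a ^ (p - 1) * (r - a)) * (a ^ (p - 1) * (b - r)) := by positivity
    linarith
  have h4 := rpow_sub_rpow_le hp hv0 hvF hF1
  calc v / p * (a ^ (p - 1)) ^ 2 * ((r - a) * (b - r))
      = v / p * ((a ^ (p - 1) * (r - a)) * (a ^ (p - 1) * (b - r))) := by ring
    _ ≤ v / p * (p * (F - v)) := mul_le_mul_of_nonneg_left (h3.trans h4) (by positivity)
    _ = v * (F - v) := by field_simp
    _ ≤ F ^ 2 - v ^ 2 := by nlinarith
    _ ≤ (F ^ 2 - v ^ 2) / r ^ 2 := by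
      rw [le_div_iff₀ (by positivity)]
      have : r ^ 2 ≤ 1 := by nlinarith
      exact mul_le_of_le_one_right (by nlinarith) this

lemma radicand_pos (hp : 1 ≤ p) (hv : v ∈ Ioo 0 ((1 / 4 : ℝ) ^ (1 / p))) {r : ℝ}
    (hr : r ∈ Ioo (rMinus p v) (rPlus p v)) :
    0 < (1 - r ^ p) ^ (2 / p) - v ^ 2 / r ^ 2 := by
  obtain ⟨k, hk, h⟩ := exists_le_radicand hp hv
  exact lt_of_lt_of_le (mul_pos hk (mul_pos (sub_pos.2 hr.1) (sub_pos.2 hr.2))) (h r hr)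

lemma intervalIntegrable_deriv_integrand (hp : 1 ≤ p)
    (hv : v ∈ Ioo 0 ((1 / 4 : ℝ) ^ (1 / p))) :
    IntervalIntegrable (fun r => ((1 - r ^ p) ^ (2 / p) - v ^ 2 / r ^ 2) ^ (-(1 / 2 : ℝ)) *
      (v / r ^ 2)) volume (rMinus p v) (rPlus p v) := by
  obtain ⟨k, hk, h⟩ := exists_le_radicand hp hv
  have hab := rMinus_lt_rPlus hp hv
  have ha := rMinus_pos hp hv
  have hv0 := hv.1
  have hI := (intervalIntegrable_rpow_neg_half_mul hab).const_mul
    (k ^ (-(1 / 2 : ℝ)) * (v / rMinus p v ^ 2))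
  rw [intervalIntegrable_iff_integrableOn_Ioo_of_le hab.le] at hI ⊢
  refine hI.mono' (by fun_prop) ?_
  rw [ae_restrict_iff' measurableSet_Ioo]
  refine Eventually.of_forall fun r hr => ?_
  have hP := radicand_pos hp hv hr
  have hr0 : 0 < r := ha.trans hr.1
  have hq : 0 < (r - rMinus p v) * (rPlus p v - r) :=
    mul_pos (sub_pos.2 hr.1) (sub_pos.2 hr.2)
  rw [Real.norm_of_nonneg (by positivity)]
  calc _ ≤ (k * ((r - rMinus p v) * (rPlus p v - r))) ^ (-(1 / 2 : ℝ)) *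
        (v / rMinus p v ^ 2) := by
        refine mul_le_mul (Real.rpow_le_rpow_of_nonpos (by positivity) (h r hr) (by norm_num)) ?_
          (by positivity) (by positivity)
        have := hr.1.le
        gcongr
    _ = _ := by rw [Real.mul_rpow hk.le hq.le]; ring

lemma intervalIntegrable_integrand (hp : 1 ≤ p) (w : ℝ) {a b : ℝ} (ha : 0 < a) (hb : 0 < b) :
    IntervalIntegrable (fun r => √((1 - r ^ p) ^ (2 / p) - w ^ 2 / r ^ 2)) volume a b := by
  refine ContinuousOn.intervalIntegrable fun r hr => ContinuousAt.continuousWithinAt ?_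
  have hr0 : r ≠ 0 := ((lt_min ha hb).trans_le hr.1).ne'
  refine ((((continuousAt_const.sub (Real.continuousAt_rpow_const r p (Or.inl hr0))).rpow_const
    (Or.inr (by positivity))).sub (continuousAt_const.div (continuousAt_id.pow 2)
      (pow_ne_zero 2 hr0)))).sqrt

lemma continuousAt_integrand (hp : 1 ≤ p) (w : ℝ) {r : ℝ} (hr : 0 < r) :
    ContinuousAt (fun z : ℝ × ℝ => √((1 - z.2 ^ p) ^ (2 / p) - z.1 ^ 2 / z.2 ^ 2)) (w, r) := by
  refine ((((continuousAt_const.sub (continuousAt_snd.rpow_const (Or.inl hr.ne'))).rpow_const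
    (Or.inr (by positivity))).sub ((continuousAt_fst.pow 2).div (continuousAt_snd.pow 2)
      (pow_ne_zero 2 hr.ne')))).sqrt

lemma hasDerivAt_integrand {r : ℝ} (hP : 0 < (1 - r ^ p) ^ (2 / p) - v ^ 2 / r ^ 2) :
    HasDerivAt (fun w => √((1 - r ^ p) ^ (2 / p) - w ^ 2 / r ^ 2))
      (-(((1 - r ^ p) ^ (2 / p) - v ^ 2 / r ^ 2) ^ (-(1 / 2 : ℝ)) * (v / r ^ 2))) v := by
  convert (((hasDerivAt_pow 2 v).div_const (r ^ 2)).const_sub ((1 - r ^ p) ^ (2 / p))).sqrt hP.ne'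
    using 1
  rw [Real.rpow_neg hP.le, ← Real.sqrt_eq_rpow]
  have := Real.sqrt_pos.2 hP
  field_simp
  norm_num

/-- Differentiation under the integral sign with the endpoints frozen at `r₋(v)`, `r₊(v)`. -/
lemma hasDerivAt_integral_fixed_endpoints (hp : 1 ≤ p)
    (hv : v ∈ Ioo 0 ((1 / 4 : ℝ) ^ (1 / p))) :
    HasDerivAt (fun w => ∫ r in rMinus p v..rPlus p v, √((1 - r ^ p) ^ (2 / p) - w ^ 2 / r ^ 2))
      (-∫ r in rMinus p v..rPlus p v,
        ((1 - r ^ p) ^ (2 / p) - v ^ 2 / r ^ 2) ^ (-(1 / 2 : ℝ)) * (v / r ^ 2)) v := by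
  have ha := rMinus_pos hp hv
  have hab := rMinus_lt_rPlus hp hv
  have hb := ha.trans hab
  have hv0 := hv.1
  have hmem : ∀ᵐ r, r ∈ uIoc (rMinus p v) (rPlus p v) → r ∈ Ioo (rMinus p v) (rPlus p v) := by
    have : ∀ᵐ r : ℝ, r ≠ rPlus p v := by simp [ae_iff]
    filter_upwards [this] with r hne hr
    rw [uIoc_of_le hab.le] at hr
    exact ⟨hr.1, lt_of_le_of_ne hr.2 hne⟩
  rw [hasDerivAt_iff_tendsto_slope, ← intervalIntegral.integral_neg]
  have hslope : ∀ w, slope (fun w => ∫ r in rMinus p v..rPlus p v,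
      √((1 - r ^ p) ^ (2 / p) - w ^ 2 / r ^ 2)) v w = ∫ r in rMinus p v..rPlus p v,
        slope (fun w => √((1 - r ^ p) ^ (2 / p) - w ^ 2 / r ^ 2)) v w := by
    intro w
    simp only [slope_def_module, smul_eq_mul]
    rw [intervalIntegral.integral_const_mul, intervalIntegral.integral_sub
      (intervalIntegrable_integrand hp w ha hb) (intervalIntegrable_integrand hp v ha hb)]
  simp_rw [funext hslope]
  refine intervalIntegral.tendsto_integral_filter_of_dominated_convergence
    (fun r => (2 * v + 1) / v * (((1 - r ^ p) ^ (2 / p) - v ^ 2 / r ^ 2) ^ (-(1 / 2 : ℝ)) *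
      (v / r ^ 2))) ?_ ?_ ((intervalIntegrable_deriv_integrand hp hv).const_mul _) ?_
  · refine Eventually.of_forall fun w => ?_
    simp only [slope_def_module, smul_eq_mul]
    fun_prop
  · have hball : ∀ᶠ w in 𝓝[≠] v, |w - v| < 1 :=
      nhdsWithin_le_nhds (Metric.ball_mem_nhds v one_pos)
    filter_upwards [hball, self_mem_nhdsWithin] with w hw hne
    filter_upwards [hmem] with r hr hr'
    have hP := radicand_pos hp hv (hr hr')
    have hr0 : 0 < r := ha.trans (hr hr').1
    have hwv : 0 < |w - v| := abs_pos.2 (sub_ne_zero.2 hne)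
    have hle : |w + v| ≤ 2 * v + 1 := by
      rw [abs_lt] at hw
      rw [abs_le]
      constructor <;> linarith
    have hS := abs_sqrt_sub_sqrt_le ((1 - r ^ p) ^ (2 / p) - w ^ 2 / r ^ 2) hP
    have heq : |(1 - r ^ p) ^ (2 / p) - w ^ 2 / r ^ 2 - ((1 - r ^ p) ^ (2 / p) - v ^ 2 / r ^ 2)| =
        |w - v| * |w + v| / r ^ 2 := by
      rw [← abs_mul, ← abs_neg, ← abs_of_pos (pow_pos hr0 2), ← abs_div,
        abs_of_pos (pow_pos hr0 2)]
      congr 1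
      ring
    rw [heq] at hS
    rw [slope_def_field, norm_div, Real.norm_eq_abs, Real.norm_eq_abs, div_le_iff₀ hwv]
    refine hS.trans ?_
    set c := ((1 - r ^ p) ^ (2 / p) - v ^ 2 / r ^ 2) ^ (-(1 / 2 : ℝ))
    have hc : 0 < c := Real.rpow_pos_of_pos hP _
    calc |w - v| * |w + v| / r ^ 2 * c ≤ |w - v| * (2 * v + 1) / r ^ 2 * c := by gcongr
      _ = _ := by field_simp
  · filter_upwards [hmem] with r hr hr'
    exact hasDerivAt_iff_tendsto_slope.1 (hasDerivAt_integrand (radicand_pos hp hv (hr hr')))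

end

/-- for `p ≥ 1` and `v ∈ (0, (1/4)^(1/p))`, `g_p` is differentiable at
`v` with derivative `−2∫_{r₋(v)}^{r₊(v)} ((1 − r^p)^(2/p) − v²/r²)^(−1/2)·(v/r²) dr`,
and this derivative is negative. -/
theorem g_hasDerivAt (p v : ℝ) (hp : 1 ≤ p) (hv : v ∈ Set.Ioo 0 ((1 / 4 : ℝ) ^ (1 / p))) :
    HasDerivAt (g p)
      (-2 * ∫ r in rMinus p v..rPlus p v,
        ((1 - r ^ p) ^ (2 / p) - v ^ 2 / r ^ 2) ^ (-(1 / 2 : ℝ)) * (v / r ^ 2)) v ∧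
    (-2 * ∫ r in rMinus p v..rPlus p v,
        ((1 - r ^ p) ^ (2 / p) - v ^ 2 / r ^ 2) ^ (-(1 / 2 : ℝ)) * (v / r ^ 2)) < 0 := by
  have ha := rMinus_pos hp hv
  have hab := rMinus_lt_rPlus hp hv
  have hb := ha.trans hab
  constructor
  · have hm := hasDerivAt_integral_moving_endpoint
      (f := fun w r => √((1 - r ^ p) ^ (2 / p) - w ^ 2 / r ^ 2))
      (continuousAt_integrand hp v ha) (by simp only [radicand_rMinus hp hv, Real.sqrt_zero])
      (differentiableAt_rMinus hp hv)
    have hM := hasDerivAt_integral_moving_endpoint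
      (f := fun w r => √((1 - r ^ p) ^ (2 / p) - w ^ 2 / r ^ 2))
      (continuousAt_integrand hp v hb) (by simp only [radicand_rPlus hp hv, Real.sqrt_zero])
      (differentiableAt_rPlus hp hv)
    have h := (((hasDerivAt_integral_fixed_endpoints hp hv).sub hm).add hM).const_mul 2
    rw [sub_zero, add_zero, mul_neg, ← neg_mul] at h
    refine h.congr_of_eventuallyEq ?_
    filter_upwards [isOpen_Ioo.mem_nhds hv] with w hw
    have ha' := rMinus_pos hp hw
    have hb' := ha'.trans (rMinus_lt_rPlus hp hw)
    have hint := fun {x y : ℝ} => intervalIntegrable_integrand hp w (a := x) (b := y)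
    simp only [g, Pi.add_apply, Pi.sub_apply]
    rw [← intervalIntegral.integral_add_adjacent_intervals (hint ha' ha) (hint ha hb'),
      ← intervalIntegral.integral_add_adjacent_intervals (hint ha hb) (hint hb hb'),
      intervalIntegral.integral_symm (rMinus p v) (rMinus p w)]
    ring
  · have hpos := intervalIntegral.intervalIntegral_pos_of_pos_on
      (intervalIntegrable_deriv_integrand hp hv) (fun r hr => mul_pos
        (Real.rpow_pos_of_pos (radicand_pos hp hv hr) _)
        (div_pos hv.1 (pow_pos (ha.trans hr.1) 2))) hab
    linarith
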